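/- The complete list of reversed sum-product pairs (a,b) with a ≤ b for base 10 is: (2,2), (9,9), (3,24), and (2, b_n) for n ≥ 0, where b_n has decimal digits 4, then n nines, then 7 (i.e., b_n ∈ {47, 497, 4997, 49997, ...}), that is, b_n = 5·10^{n+1} - 3; concretely, (a,b) with a ≤ b is a reversed sum-product pair for base 10 if and only if (a,b) = (2,2), (9,9), (3,24), or a = 2 and b = 5·10^{n+1} - 3 for some n ≥ 0. -/

import Mathlib

/-- `(a, b)` is a reversed sum-product pair for base `β`: `a ≤ b` are positive
integers and the base-`β` digit sequence of `a * b` is the reverse of that of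
`a + b` (in particular they have the same number of digits). -/
def IsRSP (β a b : ℕ) : Prop :=
  0 < a ∧ a ≤ b ∧ Nat.digits β (a * b) = (Nat.digits β (a + b)).reverse

/-- The value of a little-endian digit list, as an integer. -/
def valZ (w : List ℕ) : ℤ := ((Nat.ofDigits 10 w : ℕ) : ℤ)

theorem valZ_nil : valZ [] = 0 := by
  simp [valZ]

theorem valZ_single (v : ℕ) : valZ [v] = v := by
  simp [valZ]

/-- The digit equation `a * x = rev x + e + f * 10 ^ length`. -/
def DigEqn (a e f : ℤ) (w : List ℕ) : Prop :=
  a * valZ w = valZ w.reverse + e + f * 10 ^ w.length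

theorem valZ_cons (v : ℕ) (y : List ℕ) : valZ (v :: y) = v + 10 * valZ y := by
  unfold valZ
  rw [Nat.ofDigits_cons]
  push_cast
  rfl

theorem valZ_snoc (u : ℕ) (y : List ℕ) :
    valZ (y ++ [u]) = valZ y + 10 ^ y.length * u := by
  unfold valZ
  rw [Nat.ofDigits_append, Nat.ofDigits_singleton]
  push_cast
  rfl

theorem valZ_nonneg (w : List ℕ) : 0 ≤ valZ w := by
  induction w with
  | nil => simp [valZ_nil, valZ_single]
  | cons v y ih => rw [valZ_cons]; positivity

theorem valZ_lt (w : List ℕ) (h : ∀ d ∈ w, d < 10) : valZ w + 1 ≤ 10 ^ w.length := by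
  induction w with
  | nil => simp [valZ_nil, valZ_single]
  | cons v y ih =>
    rw [valZ_cons, List.length_cons, pow_succ]
    have h1 := ih (fun d hd => h d (by simp [hd]))
    have h2 := h v (by simp)
    omega

theorem dig_peel (a e f : ℤ) (v u : ℕ) (y : List ℕ) (h : DigEqn a e f (v :: (y ++ [u]))) :
    (u + e - a * v) % 10 = 0 ∧ DigEqn a ((u + e - a * v) / 10) (10 * f + v - a * u) y := by
  unfold DigEqn at h ⊢
  have hr : (v :: (y ++ [u])).reverse = u :: (y.reverse ++ [v]) := by simp
  rw [hr, valZ_cons, valZ_cons, valZ_snoc, valZ_snoc] at h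
  simp only [List.length_cons, List.length_append, List.length_nil, List.length_reverse,
    zero_add, pow_succ] at h
  have key : (u + e - a * v) = 10 * (a * valZ y - valZ y.reverse
      - (10 * f + v - a * u) * 10 ^ y.length) := by linarith
  constructor
  · omega
  · have : (u + e - a * v) / 10 = a * valZ y - valZ y.reverse
      - (10 * f + v - a * u) * 10 ^ y.length := by omega
    rw [this]; ring

theorem dig_bound (a e f : ℤ) (w : List ℕ) (hw : ∀ d ∈ w, d < 10) (ha : 1 ≤ a) (ha' : a ≤ 9)
    (he : -9 ≤ e) (he' : e ≤ 9) (h : DigEqn a e f w) : -9 ≤ f ∧ f ≤ 9 := by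
  unfold DigEqn at h
  have h1 := valZ_lt w hw
  have h2 := valZ_lt w.reverse (fun d hd => hw d (by simpa using hd))
  have h3 := valZ_nonneg w
  have h4 := valZ_nonneg w.reverse
  rw [List.length_reverse] at h2
  generalize (10 : ℤ) ^ w.length = P at *
  have hP : 1 ≤ P := by omega
  constructor
  · by_contra hc
    push Not at hc
    nlinarith
  · by_contra hc
    push Not at hc
    nlinarith

/-- Membership test for the transition target. -/
def stepOK (a e f : ℤ) (R : List (ℤ × ℤ)) (u v : ℕ) : Bool :=
  !(decide ((u + e - a * v) % 10 = 0)) || decide (10 * f + v - a * u < -9) ||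
    decide (9 < 10 * f + v - a * u) ||
    R.contains ((u + e - a * v) / 10, 10 * f + v - a * u)

/-- Closure certificate. -/
def certOK (a : ℤ) (R : List (ℤ × ℤ)) : Bool :=
  R.all fun s => decide (-9 ≤ s.1) && decide (s.1 ≤ 9) && decide (s.1 + s.2 ≠ 0) &&
    (List.range 10).all (fun x => decide (a * x ≠ x + s.1 + 10 * s.2)) &&
    (List.range 10).all (fun u => (List.range 10).all fun v => stepOK a s.1 s.2 R u v)

theorem step_mem (a e f : ℤ) (R : List (ℤ × ℤ)) (v u : ℕ) (y : List ℕ)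
    (hd : ∀ d ∈ v :: (y ++ [u]), d < 10) (ha : 1 ≤ a) (ha' : a ≤ 9)
    (he : -9 ≤ (u + e - a * v) / 10) (he' : (u + e - a * v) / 10 ≤ 9)
    (h : DigEqn a e f (v :: (y ++ [u]))) (hs : stepOK a e f R u v = true) :
    ((u + e - a * v) / 10, 10 * f + v - a * u) ∈ R := by
  obtain ⟨h1, h2⟩ := dig_peel a e f v u y h
  have h3 := dig_bound _ _ _ y (fun d hd' => hd d (by simp [hd'])) ha ha' he he' h2
  simp only [stepOK, Bool.or_eq_true, Bool.not_eq_true', decide_eq_false_iff_not,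
    decide_eq_true_eq, List.contains_iff_mem] at hs
  rcases hs with ((hs | hs) | hs) | hs
  · exact absurd h1 hs
  · omega
  · omega
  · exact hs

theorem e_bound (a e : ℤ) (u v : ℕ) (hu : u < 10) (hv : v < 10) (ha : 1 ≤ a) (ha' : a ≤ 9)
    (he : -9 ≤ e) (he' : e ≤ 81) :
    -9 ≤ (u + e - a * v) / 10 ∧ (u + e - a * v) / 10 ≤ 9 := by
  have h1 : a * v ≤ 81 := by
    have : (v : ℤ) ≤ 9 := by omega
    nlinarith
  have h2 : 0 ≤ a * v := by positivity
  omega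

theorem list_cases (w : List ℕ) : w = [] ∨ (∃ v, w = [v]) ∨ ∃ v y u, w = v :: (y ++ [u]) := by
  rcases w with _ | ⟨v, t⟩
  · simp
  · rcases List.eq_nil_or_concat t with h | ⟨y, u, h⟩
    · right; left; exact ⟨v, by rw [h]⟩
    · right; right; exact ⟨v, y, u, by rw [h]; simp⟩

theorem dead (a : ℤ) (R : List (ℤ × ℤ)) (ha : 1 ≤ a) (ha' : a ≤ 9) (hR : certOK a R = true) :
    ∀ (n : ℕ) (w : List ℕ), w.length ≤ n → (∀ d ∈ w, d < 10) → ∀ e f, (e, f) ∈ R →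
      ¬ DigEqn a e f w := by
  intro n
  induction n with
  | zero =>
    intro w hn hd e f hm h
    have : w = [] := by simpa using hn
    subst this
    have hs := List.all_eq_true.1 hR _ hm
    simp only [Bool.and_eq_true, decide_eq_true_eq] at hs
    simp [DigEqn, valZ_nil, valZ_single] at h
    have := hs.1.1.2
    omega
  | succ n ih =>
    intro w hn hd e f hm h
    have hs := List.all_eq_true.1 hR _ hm
    simp only [Bool.and_eq_true, decide_eq_true_eq, List.all_eq_true, List.mem_range] at hs
    obtain ⟨⟨⟨⟨hs1, hs2⟩, hs3⟩, hs4⟩, hs5⟩ := hs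
    rcases list_cases w with rfl | ⟨v, rfl⟩ | ⟨v, y, u, rfl⟩
    · simp [DigEqn, valZ_nil, valZ_single] at h
      omega
    · have := hs4 v (hd v (by simp))
      simp [DigEqn, valZ_nil, valZ_single] at h
      apply this
      linarith
    · have hu : u < 10 := hd u (by simp)
      have hv : v < 10 := hd v (by simp)
      have hb := e_bound a e u v hu hv ha ha' hs1 (by omega)
      have hm' := step_mem a e f R v u y hd ha ha' hb.1 hb.2 h (hs5 u hu v hv)
      refine ih y ?_ (fun d hd' => hd d (by simp [hd'])) _ _ hm' (dig_peel a e f v u y h).2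
      simp at hn
      omega

/-- First-step certificate with one exceptional pair of outer digits. -/
def initOK (a : ℤ) (R : List (ℤ × ℤ)) (u0 v0 : ℕ) : Bool :=
  (List.range 10).all (fun x => decide (a * x ≠ x + a * a) || decide (a = 2)) &&
  (List.range 10).all (fun u => (List.range 10).all fun v =>
    decide (u = 0) || decide (v = 0) || decide (u = u0 ∧ v = v0) || stepOK a (a * a) 0 R u v)

/-- Certificate for an exceptional state. -/
def specOK (a e f : ℤ) (R : List (ℤ × ℤ)) (u0 v0 : ℕ) : Bool :=
  (List.range 10).all (fun u => (List.range 10).all fun v =>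
    decide (u = u0 ∧ v = v0) || stepOK a e f R u v)

theorem init_step (a : ℤ) (R : List (ℤ × ℤ)) (u0 v0 : ℕ) (ha : 1 ≤ a) (ha' : a ≤ 9)
    (hR : certOK a R = true) (hI : initOK a R u0 v0 = true) (w : List ℕ)
    (hd : ∀ d ∈ w, d < 10) (hne : w ≠ []) (h1 : w.head hne ≠ 0) (h2 : w.getLast hne ≠ 0)
    (h : DigEqn a (a * a) 0 w) :
    (a = 2 ∧ w = [4]) ∨ ∃ y, w = v0 :: (y ++ [u0]) := by
  simp only [initOK, Bool.and_eq_true, Bool.or_eq_true, decide_eq_true_eq, List.all_eq_true,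
    List.mem_range] at hI
  obtain ⟨hI1, hI2⟩ := hI
  rcases list_cases w with rfl | ⟨v, rfl⟩ | ⟨v, y, u, rfl⟩
  · simp at hne
  · left
    simp [DigEqn, valZ_nil, valZ_single] at h
    rcases hI1 v (hd v (by simp)) with h3 | h3
    · exact absurd h h3
    · subst h3
      refine ⟨rfl, ?_⟩
      have : v = 4 := by omega
      rw [this]
  · right
    have hu : u < 10 := hd u (by simp)
    have hv : v < 10 := hd v (by simp)
    have hv0 : v ≠ 0 := by simpa using h1
    have hu0 : u ≠ 0 := by simpa using h2
    rcases hI2 u hu v hv with ((h3 | h3) | ⟨h3, h4⟩) | h3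
    · exact absurd h3 hu0
    · exact absurd h3 hv0
    · subst h3; subst h4; exact ⟨y, rfl⟩
    · exfalso
      have hb := e_bound a (a * a) u v hu hv ha ha' (by nlinarith) (by nlinarith)
      have hm' := step_mem a _ _ R v u y hd ha ha' hb.1 hb.2 h h3
      exact dead a R ha ha' hR _ y le_rfl (fun d hd' => hd d (by simp [hd'])) _ _ hm'
        (dig_peel _ _ _ v u y h).2

theorem spec_step (a e f : ℤ) (R : List (ℤ × ℤ)) (u0 v0 : ℕ) (ha : 1 ≤ a) (ha' : a ≤ 9)
    (he : -9 ≤ e) (he' : e ≤ 9)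
    (hR : certOK a R = true) (hI : specOK a e f R u0 v0 = true) (w : List ℕ)
    (hd : ∀ d ∈ w, d < 10) (h : DigEqn a e f w) :
    w = [] ∨ (∃ v : ℕ, v < 10 ∧ w = [v] ∧ a * v = v + e + f * 10) ∨
      ∃ y, w = v0 :: (y ++ [u0]) := by
  simp only [specOK, Bool.or_eq_true, decide_eq_true_eq, List.all_eq_true,
    List.mem_range] at hI
  rcases list_cases w with rfl | ⟨v, rfl⟩ | ⟨v, y, u, rfl⟩
  · simp
  · right; left
    simp [DigEqn, valZ_nil, valZ_single] at h
    exact ⟨v, hd v (by simp), rfl, h⟩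
  · right; right
    have hu : u < 10 := hd u (by simp)
    have hv : v < 10 := hd v (by simp)
    rcases hI u hu v hv with ⟨h3, h4⟩ | h3
    · subst h3; subst h4; exact ⟨y, rfl⟩
    · exfalso
      have hb := e_bound a e u v hu hv ha ha' he (by omega)
      have hm' := step_mem a _ _ R v u y hd ha ha' hb.1 hb.2 h h3
      exact dead a R ha ha' hR _ y le_rfl (fun d hd' => hd d (by simp [hd'])) _ _ hm'
        (dig_peel _ _ _ v u y h).2

/-- Dead states for multiplier two. -/
def R2 : List (ℤ × ℤ) := [(-1, -8), (-1, -5), (-1, 4), (-1, 7), (0, -7), (0, -4), (0, -1),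
  (0, 2), (0, 5), (0, 8)]

/-- Dead states for multiplier three. -/
def R3 : List (ℤ × ℤ) := [(-2, -6), (-2, -5), (-2, 3), (-1, -7), (-1, -3), (-1, 5),
  (0, -9), (0, -5), (0, -1), (0, 7), (0, 8)]

theorem nines (n : ℕ) : ∀ w : List ℕ, w.length ≤ n → (∀ d ∈ w, d < 10) → DigEqn 2 (-1) 1 w →
    valZ w = 10 ^ w.length - 1 := by
  induction n with
  | zero =>
    intro w hn hd h
    have : w = [] := by simpa using hn
    subst this
    simp [valZ_nil, valZ_single]
  | succ n ih =>
    intro w hn hd h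
    rcases spec_step 2 (-1) 1 R2 9 9 (by norm_num) (by norm_num) (by norm_num) (by norm_num)
      (by decide +kernel) (by decide +kernel) w hd h with rfl | ⟨v, hv, rfl, h1⟩ | ⟨y, rfl⟩
    · simp [valZ_nil, valZ_single]
    · have : v = 9 := by omega
      subst this
      simp [valZ_nil, valZ_single]
    · have h2 := (dig_peel _ _ _ _ _ y h).2
      norm_num at h2
      have h3 := ih y (by simp at hn; omega) (fun d hd' => hd d (by simp [hd'])) h2
      rw [valZ_cons, valZ_snoc, h3]
      simp only [List.length_cons, List.length_append, List.length_nil, zero_add, pow_succ]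
      push_cast
      ring

theorem digits_replicate (k : ℕ) : Nat.digits 10 (10 ^ k - 1) = List.replicate k 9 := by
  induction k with
  | zero => simp
  | succ k ih =>
    have h0 : 0 < 10 ^ k := by positivity
    have : 10 ^ (k + 1) - 1 = 9 + 10 * (10 ^ k - 1) := by rw [pow_succ]; omega
    rw [this, Nat.digits_add 10 (by norm_num) 9 _ (by norm_num) (by simp), ih,
      List.replicate_succ]

theorem digits_five (k : ℕ) :
    Nat.digits 10 (5 * 10 ^ k - 1) = List.replicate k 9 ++ [4] := by
  induction k with
  | zero => simp
  | succ k ih =>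
    have h0 : 0 < 10 ^ k := by positivity
    have : 5 * 10 ^ (k + 1) - 1 = 9 + 10 * (5 * 10 ^ k - 1) := by rw [pow_succ]; omega
    rw [this, Nat.digits_add 10 (by norm_num) 9 _ (by norm_num) (by simp), ih,
      List.replicate_succ, List.cons_append]

theorem rsp_family (n : ℕ) : IsRSP 10 2 (5 * 10 ^ (n + 1) - 3) := by
  have h0 : 0 < 10 ^ n := by positivity
  refine ⟨by norm_num, by rw [pow_succ]; omega, ?_⟩
  have h1 : 2 * (5 * 10 ^ (n + 1) - 3) = 4 + 10 * (10 ^ (n + 1) - 1) := by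
    rw [pow_succ]; omega
  have h2 : 2 + (5 * 10 ^ (n + 1) - 3) = 5 * 10 ^ (n + 1) - 1 := by
    rw [pow_succ]; omega
  rw [h1, h2, digits_five, Nat.digits_add 10 (by norm_num) 4 _ (by norm_num) (by simp),
    digits_replicate]
  simp

theorem rsp_setup (a b : ℕ) (h : IsRSP 10 a b) :
    ∃ (w : List ℕ) (hne : w ≠ []), (∀ d ∈ w, d < 10) ∧ w.head hne ≠ 0 ∧ w.getLast hne ≠ 0 ∧
      valZ w = a + b ∧ DigEqn a (a * a) 0 w := by
  obtain ⟨ha, hab, h⟩ := h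
  have hne : Nat.digits 10 (a + b) ≠ [] := Nat.digits_ne_nil_iff_ne_zero.2 (by omega)
  have hp : a * b ≠ 0 := Nat.mul_ne_zero (by omega) (by omega)
  have hv : valZ (Nat.digits 10 (a + b)) = a + b := by
    unfold valZ
    rw [Nat.ofDigits_digits]
    push_cast
    rfl
  refine ⟨Nat.digits 10 (a + b), hne, fun d hd => Nat.digits_lt_base (by norm_num) hd, ?_,
    Nat.getLast_digit_ne_zero 10 (by omega), hv, ?_⟩
  · have := Nat.getLast_digit_ne_zero 10 hp
    simp only [h] at this
    simpa using this
  · unfold DigEqn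
    have hv' : valZ (Nat.digits 10 (a + b)).reverse = a * b := by
      rw [← h]
      unfold valZ
      rw [Nat.ofDigits_digits]
      push_cast
      rfl
    rw [hv, hv']
    ring

theorem rsp_mod (a b : ℕ) (h : IsRSP 10 a b) : (a * b) % 9 = (a + b) % 9 := by
  have h1 := Nat.modEq_nine_digits_sum (a * b)
  have h2 := Nat.modEq_nine_digits_sum (a + b)
  rw [h.2.2, List.sum_reverse] at h1
  exact h1.trans h2.symm

theorem rsp_size (a b : ℕ) (h : IsRSP 10 a b) : a * b < 10 * (a + b) := by
  obtain ⟨ha, hab, h⟩ := h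
  have h1 := Nat.lt_base_pow_length_digits (b := 10) (m := a * b) (by norm_num)
  have h2 := Nat.base_pow_length_digits_le 10 (a + b) (by norm_num) (by omega)
  rw [h, List.length_reverse] at h1
  omega

theorem rsp_large : ∀ a < 20, ∀ b < 110, 11 ≤ a ∧
    a * b < 10 * (a + b) ∧ a ≤ b → Nat.digits 10 (a * b) ≠ (Nat.digits 10 (a + b)).reverse := by
  decide +kernel

theorem stmt_13 (a b : ℕ) :
    IsRSP 10 a b ↔
      (a = 2 ∧ b = 2) ∨ (a = 9 ∧ b = 9) ∨ (a = 3 ∧ b = 24) ∨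
      (a = 2 ∧ ∃ n : ℕ, b = 5 * 10 ^ (n + 1) - 3) := by
  constructor
  · intro h
    have hmod := rsp_mod a b h
    have hsize := rsp_size a b h
    have hpos := h.1
    have hab := h.2.1
    by_cases hbig : 11 ≤ a
    · exfalso
      have h20 : a < 20 := by nlinarith
      have hb : b < 110 := by
        interval_cases a <;> omega
      exact rsp_large a h20 b hb ⟨hbig, hsize, hab⟩ h.2.2
    · obtain ⟨w, hne, hd, hh, hl, hval, heq⟩ := rsp_setup a b h
      have ha10 : a ≤ 10 := by omega
      clear h hsize hbig
      interval_cases a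
      · omega
      · rcases init_step 2 R2 4 9 (by norm_num) (by norm_num) (by decide +kernel)
          (by decide +kernel) w hd hne hh hl heq with ⟨-, rfl⟩ | ⟨y, rfl⟩
        · simp [valZ_nil, valZ_single] at hval
          left; omega
        · right; right; right
          refine ⟨rfl, y.length, ?_⟩
          have h2 := (dig_peel _ _ _ _ _ y heq).2
          norm_num at h2
          have h3 := nines _ y le_rfl (fun d hd' => hd d (by simp [hd'])) h2
          rw [valZ_cons, valZ_snoc, h3] at hval
          rw [pow_succ]
          have : ((10 ^ y.length : ℕ) : ℤ) = 10 ^ y.length := by push_cast; rfl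
          rw [← this] at hval
          push_cast [-Nat.cast_pow] at hval
          omega
      · rcases init_step 3 R3 2 7 (by norm_num) (by norm_num) (by decide +kernel)
          (by decide +kernel) w hd hne hh hl heq with ⟨h0, -⟩ | ⟨y, rfl⟩
        · omega
        · have h2 := (dig_peel _ _ _ _ _ y heq).2
          norm_num at h2
          rcases spec_step 3 (-1) 1 R3 10 10 (by norm_num) (by norm_num) (by norm_num)
            (by norm_num) (by decide +kernel) (by decide +kernel) y
            (fun d hd' => hd d (by simp [hd'])) h2 with rfl | ⟨v, hv, rfl, h1⟩ | ⟨z, rfl⟩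
          · simp [valZ_nil, valZ_single, valZ_cons] at hval
            omega
          · omega
          · have := hd 10 (by simp)
            omega
      · omega
      · rcases init_step 5 [] 10 10 (by norm_num) (by norm_num) (by decide +kernel)
          (by decide +kernel) w hd hne hh hl heq with ⟨h0, -⟩ | ⟨y, rfl⟩
        · omega
        · have := hd 10 (by simp)
          omega
      · rcases init_step 6 [(-1, -4), (2, -9)] 10 10 (by norm_num) (by norm_num)
          (by decide +kernel)
          (by decide +kernel) w hd hne hh hl heq with ⟨h0, -⟩ | ⟨y, rfl⟩
        · omega
        · have := hd 10 (by simp)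
          omega
      · omega
      · rcases init_step 8 [(1, -9)] 10 10 (by norm_num) (by norm_num) (by decide +kernel)
          (by decide +kernel) w hd hne hh hl heq with ⟨h0, -⟩ | ⟨y, rfl⟩
        · omega
        · have := hd 10 (by simp)
          omega
      · rcases init_step 9 [(-8, -2), (-8, -1)] 1 8 (by norm_num) (by norm_num)
          (by decide +kernel)
          (by decide +kernel) w hd hne hh hl heq with ⟨h0, -⟩ | ⟨y, rfl⟩
        · omega
        · have h2 := (dig_peel _ _ _ _ _ y heq).2
          norm_num at h2
          rcases spec_step 9 1 (-1) [(-8, -2), (-8, -1)] 10 10 (by norm_num) (by norm_num)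
            (by norm_num)
            (by norm_num) (by decide +kernel) (by decide +kernel) y
            (fun d hd' => hd d (by simp [hd'])) h2 with rfl | ⟨v, hv, rfl, h1⟩ | ⟨z, rfl⟩
          · simp [valZ_nil, valZ_single, valZ_cons] at hval
            omega
          · omega
          · have := hd 10 (by simp)
            omega
      · omega
  · rintro (⟨rfl, rfl⟩ | ⟨rfl, rfl⟩ | ⟨rfl, rfl⟩ | ⟨rfl, n, rfl⟩)
    · simp [IsRSP]
    · simp [IsRSP]
    · simp [IsRSP]
    · exact rsp_family n
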